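/- For every integer n ≥ 2 and α ∈ ℝ: (i) ψ_α[A+B] − ψ_α[A] − ψ_α[B] is positive semidefinite for all n×n real symmetric positive semidefinite matrices A, B of rank at most one if and only if α ∈ {odd positive integers} ∪ [n, ∞); (ii) φ_α[A+B] − φ_α[A] − φ_α[B] is positive semidefinite for all n×n real symmetric positive semidefinite matrices A, B of rank at most one if and only if α ∈ {even positive integers} ∪ [n, ∞); and (iii) (A+B)^{∘α} − A^{∘α} − B^{∘α} is positive semidefinite for all n×n real symmetric positive semidefinite matrices A, B of rank at most one with nonnegative entries if and only if α ∈ ℕ ∪ [n, ∞). -/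

import Mathlib

open Matrix

/-- Entrywise power with the convention `0 ^ α := 0` for all `α`. -/
noncomputable def powF (α x : ℝ) : ℝ := if x = 0 then 0 else x ^ α

/-- `ψ_α(x) := sgn(x) * |x| ^ α`, with `ψ_α(0) := 0`. -/
noncomputable def psiF (α x : ℝ) : ℝ := if x = 0 then 0 else Real.sign x * |x| ^ α

/-- `φ_α(x) := |x| ^ α`, with `φ_α(0) := 0`. -/
noncomputable def phiF (α x : ℝ) : ℝ := if x = 0 then 0 else |x| ^ α

theorem psd_iff_sum {n : ℕ} (M : Matrix (Fin n) (Fin n) ℝ) :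
    M.PosSemidef ↔ (∀ i j, M i j = M j i) ∧
      ∀ x : Fin n → ℝ, 0 ≤ ∑ i, ∑ j, x i * x j * M i j := by
  rw [posSemidef_iff_dotProduct_mulVec]
  refine and_congr ?_ (forall_congr' fun x => ?_)
  · rw [IsHermitian.ext_iff]
    simp only [star_trivial]
    exact ⟨fun h i j => (h i j).symm, fun h i j => (h i j).symm⟩
  · have : star x ⬝ᵥ M *ᵥ x = ∑ i, ∑ j, x i * x j * M i j := by
      simp only [dotProduct, mulVec, star_trivial, Finset.mul_sum]
      refine Finset.sum_congr rfl fun i _ => Finset.sum_congr rfl fun j _ => by ring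
    rw [this]

/-- The two functions in one family: `true` is `ψ`, `false` is `φ`. -/
noncomputable def FF (b : Bool) (α x : ℝ) : ℝ := if b then psiF α x else phiF α x

theorem FF_zero (b : Bool) (α : ℝ) : FF b α 0 = 0 := by
  cases b <;> simp [FF, psiF, phiF]

theorem FF_mul (b : Bool) (α x y : ℝ) : FF b α (x * y) = FF b α x * FF b α y := by
  by_cases hx : x = 0
  · simp [hx, FF_zero]
  by_cases hy : y = 0
  · simp [hy, FF_zero]
  have h : |x * y| ^ α = |x| ^ α * |y| ^ α := by
    rw [abs_mul, Real.mul_rpow (abs_nonneg _) (abs_nonneg _)]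
  have hs : Real.sign (x * y) = Real.sign x * Real.sign y := by
    rcases lt_or_gt_of_ne hx with h1 | h1 <;> rcases lt_or_gt_of_ne hy with h2 | h2
    · rw [Real.sign_of_pos (mul_pos_of_neg_of_neg h1 h2), Real.sign_of_neg h1, Real.sign_of_neg h2]
      norm_num
    · rw [Real.sign_of_neg (mul_neg_of_neg_of_pos h1 h2), Real.sign_of_neg h1, Real.sign_of_pos h2]
      norm_num
    · rw [Real.sign_of_neg (mul_neg_of_pos_of_neg h1 h2), Real.sign_of_pos h1, Real.sign_of_neg h2]
      norm_num
    · rw [Real.sign_of_pos (mul_pos h1 h2), Real.sign_of_pos h1, Real.sign_of_pos h2]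
      norm_num
  cases b
  · simp only [FF, phiF, hx, hy, h, mul_eq_zero, or_self, if_false, Bool.false_eq_true]
  · simp only [FF, psiF, hx, hy, h, hs, mul_eq_zero, or_self, if_false, if_true]
    ring

theorem FF_of_pos (b : Bool) (α : ℝ) {x : ℝ} (hx : 0 < x) : FF b α x = x ^ α := by
  cases b <;> simp [FF, psiF, phiF, hx.ne', abs_of_pos hx, Real.sign_of_pos hx]

theorem FF_mono (b : Bool) {α : ℝ} (hα : 0 < α) {x y : ℝ} (hx : 0 ≤ x) (hxy : x ≤ y) :
    FF b α x ≤ FF b α y := by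
  rcases hx.eq_or_lt with rfl | hx
  · rcases hxy.eq_or_lt with rfl | hy
    · rfl
    · rw [FF_zero, FF_of_pos b α hy]; positivity
  · rw [FF_of_pos b α hx, FF_of_pos b α (hx.trans_le hxy)]
    exact Real.rpow_le_rpow hx.le hxy hα.le

theorem phi_eq {α : ℝ} (hα : α ≠ 0) (x : ℝ) : phiF α x = |x| ^ α := by
  unfold phiF
  split_ifs with h
  · simp [h, Real.zero_rpow hα]
  · rfl

theorem psi_eq (α : ℝ) (x : ℝ) : psiF α x = x * |x| ^ (α - 1) := by
  unfold psiF
  split_ifs with h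
  · simp [h]
  · rw [Real.rpow_sub_one (abs_pos.2 h).ne']
    rcases lt_or_gt_of_ne h with h1 | h1
    · rw [Real.sign_of_neg h1, abs_of_neg h1]; field_simp
    · rw [Real.sign_of_pos h1, abs_of_pos h1]; field_simp

theorem FF_deriv (b : Bool) {α : ℝ} (hα : 1 < α) (x : ℝ) :
    HasDerivAt (FF b α) (α * FF (!b) (α - 1) x) x := by
  cases b
  · have h := hasDerivAt_abs_rpow x hα
    have e : FF false α = fun x => |x| ^ α := by
      funext x; exact phi_eq (by linarith) x
    rw [e]
    convert h using 1
    simp only [FF, Bool.not_false, if_true, psi_eq]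
    rw [show α - 1 - 1 = α - 2 by ring]; ring
  · have e : FF true α = fun x => x * |x| ^ (α - 1) := by
      funext x; exact psi_eq α x
    rw [e]
    have e2 : FF (!true) (α - 1) x = |x| ^ (α - 1) := phi_eq (by linarith) x
    rw [e2]
    by_cases hx : x = 0
    · subst hx
      rw [hasDerivAt_iff_tendsto_slope]
      have : Filter.Tendsto (fun y : ℝ => |y| ^ (α - 1)) (nhdsWithin 0 {0}ᶜ)
          (nhds (α * |(0:ℝ)| ^ (α - 1))) := by
        have hc : Continuous (fun y : ℝ => |y| ^ (α - 1)) :=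
          continuous_abs.rpow_const (fun _ => Or.inr (by linarith))
        have := hc.tendsto 0
        simp only [abs_zero, Real.zero_rpow (show α - 1 ≠ 0 by linarith), mul_zero] at this ⊢
        exact this.mono_left nhdsWithin_le_nhds
      refine this.congr' ?_
      filter_upwards [self_mem_nhdsWithin] with y hy
      have hy : y ≠ 0 := hy
      rw [slope_def_field]
      field_simp
      simp
    · have h1 : HasDerivAt (fun y : ℝ => |y|) (SignType.sign x : ℝ) x := hasDerivAt_abs hx
      have h2 := (hasDerivAt_id x).mul (h1.rpow_const (p := α - 1) (Or.inl (abs_pos.2 hx).ne'))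
      refine HasDerivAt.congr_deriv (f := fun y => y * |y| ^ (α - 1)) h2 ?_
      simp only [id]
      rw [Real.rpow_sub_one (abs_pos.2 hx).ne' (α - 1)]
      have : x * (SignType.sign x : ℝ) = |x| := self_mul_sign x
      have h3 : |x| ≠ 0 := (abs_pos.2 hx).ne'
      field_simp
      linear_combination (α - 1) * this

theorem family_psd {n : ℕ} (G G' : ℝ → Matrix (Fin n) (Fin n) ℝ)
    (hs : ∀ t i j, G t i j = G t j i)
    (hd : ∀ t i j, HasDerivAt (fun s => G s i j) (G' t i j) t)
    (hp : ∀ t, 0 ≤ t → (G' t).PosSemidef) : (G 1 - G 0).PosSemidef := by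
  rw [psd_iff_sum]
  refine ⟨fun i j => by simp [hs _ i j], fun x => ?_⟩
  have hg : ∀ t, HasDerivAt (fun s => ∑ i, ∑ j, x i * x j * G s i j)
      (∑ i, ∑ j, x i * x j * G' t i j) t := fun t =>
    HasDerivAt.fun_sum fun i _ => HasDerivAt.fun_sum fun j _ => (hd t i j).const_mul _
  have hm : MonotoneOn (fun s => ∑ i, ∑ j, x i * x j * G s i j) (Set.Ici 0) := by
    refine monotoneOn_of_deriv_nonneg (convex_Ici 0)
      (fun t _ => (hg t).continuousAt.continuousWithinAt)
      (fun t _ => (hg t).differentiableAt.differentiableWithinAt) fun t ht => ?_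
    rw [interior_Ici] at ht
    rw [(hg t).deriv]
    exact ((psd_iff_sum _).1 (hp t (le_of_lt ht))).2 x
  have := hm (Set.mem_Ici.2 le_rfl) (Set.mem_Ici.2 zero_le_one) zero_le_one
  simp only [Matrix.sub_apply, mul_sub, Finset.sum_sub_distrib]
  linarith

/-- Schur complement. -/
theorem schur_psd {n : ℕ} {A : Matrix (Fin (n+1)) (Fin (n+1)) ℝ} (hA : A.PosSemidef)
    (k : Fin (n+1)) :
    (A - vecMulVec (fun i => A i k / √(A k k)) (fun i => A i k / √(A k k))).PosSemidef ∧
      ∀ i, A i k = A i k / √(A k k) * (A k k / √(A k k)) := by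
  have hA' := (psd_iff_sum A).1 hA
  have hk : 0 ≤ A k k := hA.diag_nonneg
  have key : ∀ (x : Fin (n+1) → ℝ) (c : ℝ), 0 ≤ ∑ i, ∑ j, x i * x j * A i j
      + 2 * c * ∑ i, x i * A i k + c ^ 2 * A k k := by
    intro x c
    have h := hA.dotProduct_mulVec_nonneg (x + c • Pi.single k 1)
    have e : A *ᵥ Pi.single k 1 = fun i => A i k := by
      ext i; simp
    have e2 : (Pi.single k 1 : Fin (n+1) → ℝ) ⬝ᵥ (A *ᵥ x) = ∑ i, x i * A i k := by
      rw [single_one_dotProduct]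
      simp only [mulVec, dotProduct]
      exact Finset.sum_congr rfl fun i _ => by rw [hA'.1 k i]; ring
    have e3 : x ⬝ᵥ (A *ᵥ x) = ∑ i, ∑ j, x i * x j * A i j := by
      simp only [dotProduct, mulVec, Finset.mul_sum]
      refine Finset.sum_congr rfl fun i _ => Finset.sum_congr rfl fun j _ => by ring
    have e4 : x ⬝ᵥ (fun i => A i k) = ∑ i, x i * A i k := rfl
    rw [star_trivial, mulVec_add, mulVec_smul, add_dotProduct, dotProduct_add, dotProduct_add,
      smul_dotProduct, smul_dotProduct, dotProduct_smul, dotProduct_smul, e, e2, e3, e4,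
      single_one_dotProduct] at h
    simp only [smul_eq_mul] at h
    linarith
  rcases hk.eq_or_lt with h0 | hpos
  · have hz : ∀ i, A i k = 0 := by
      intro i
      by_contra hne
      have h1 : ∀ c : ℝ, 0 ≤ A i i + 2 * c * A i k := by
        intro c
        have := key (Pi.single i 1) c
        simpa [Pi.single_apply, ← h0] using this
      have := h1 (-(A i i + 1) / (2 * A i k))
      field_simp at this
      linarith
    simp only [hz]
    refine ⟨?_, by simp⟩
    convert hA using 1
    ext i j; simp [vecMulVec_apply]
  · have hsq : √(A k k) * √(A k k) = A k k := Real.mul_self_sqrt hk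
    have hsp : 0 < √(A k k) := Real.sqrt_pos.2 hpos
    refine ⟨?_, fun i => ?_⟩
    · rw [psd_iff_sum]
      refine ⟨fun i j => by simp [vecMulVec_apply, hA'.1 i j]; ring, fun x => ?_⟩
      have h := key x (-(∑ i, x i * A i k) / A k k)
      have e : ∑ i, ∑ j, x i * x j * (A - vecMulVec (fun i => A i k / √(A k k))
          (fun i => A i k / √(A k k))) i j
          = ∑ i, ∑ j, x i * x j * A i j - (∑ i, x i * A i k) * (∑ j, x j * A j k) / A k k := by
        rw [Finset.sum_mul_sum, Finset.sum_div, ← Finset.sum_sub_distrib]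
        refine Finset.sum_congr rfl fun i _ => ?_
        rw [Finset.sum_div, ← Finset.sum_sub_distrib]
        refine Finset.sum_congr rfl fun j _ => ?_
        simp only [Matrix.sub_apply, vecMulVec_apply]
        rw [div_mul_div_comm, hsq]
        ring
      rw [e]
      convert h using 1
      field_simp
      ring
    · rw [div_mul_div_comm, hsq]
      field_simp

def PosProp (n : ℕ) : Prop := ∀ (b : Bool) (α : ℝ), (n : ℝ) - 2 < α →
  ∀ A : Matrix (Fin n) (Fin n) ℝ, A.PosSemidef → (A.map (FF b α)).PosSemidef

def MonProp (n : ℕ) : Prop := ∀ (b : Bool) (α : ℝ), (n : ℝ) - 1 < α →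
  ∀ A B : Matrix (Fin n) (Fin n) ℝ, A.PosSemidef → B.PosSemidef →
    ((A + B).map (FF b α) - A.map (FF b α)).PosSemidef

theorem pos_of_mon {n : ℕ} (h : MonProp n) : PosProp (n + 1) := by
  intro b α hα A hA
  obtain ⟨h1, h2⟩ := schur_psd hA (Fin.last n)
  have hα' : (n : ℝ) - 1 < α := by push_cast at hα; linarith
  set z : Fin (n+1) → ℝ := fun i => A i (Fin.last n) / √(A (Fin.last n) (Fin.last n)) with hz
  have hZ : (vecMulVec z z).PosSemidef := by
    simpa using posSemidef_vecMulVec_self_star z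
  have hm := h b α hα' _ _ (hZ.submatrix Fin.castSucc) (h1.submatrix Fin.castSucc)
  have hsymm : ∀ i j, A i j = A j i := ((psd_iff_sum A).1 hA).1
  rw [psd_iff_sum] at hm ⊢
  refine ⟨fun i j => by simp [hsymm i j], fun x => ?_⟩
  have hx := hm.2 (fun i => x i.castSucc)
  have e : ∀ i j, FF b α (A i j) = (FF b α (A i j) - FF b α (z i * z j))
      + FF b α (z i) * FF b α (z j) := by
    intro i j; rw [FF_mul]; ring
  have e1 : ∀ i, FF b α (A i (Fin.last n)) - FF b α (z i * z (Fin.last n)) = 0 := by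
    intro i
    rw [sub_eq_zero]; congr 1; exact h2 i
  have e2 : ∀ j, FF b α (A (Fin.last n) j) - FF b α (z (Fin.last n) * z j) = 0 := by
    intro j
    rw [hsymm, mul_comm]; exact e1 j
  have e3 : ∑ i, ∑ j, x i * x j * (A.map (FF b α)) i j
      = ∑ i, ∑ j, x i * x j * (FF b α (A i j) - FF b α (z i * z j))
      + (∑ i, x i * FF b α (z i)) * (∑ i, x i * FF b α (z i)) := by
    rw [Finset.sum_mul_sum, ← Finset.sum_add_distrib]
    refine Finset.sum_congr rfl fun i _ => ?_
    rw [← Finset.sum_add_distrib]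
    refine Finset.sum_congr rfl fun j _ => ?_
    rw [map_apply, FF_mul]; ring
  rw [e3]
  refine add_nonneg ?_ (mul_self_nonneg _)
  rw [Fin.sum_univ_castSucc]
  simp only [e2, mul_zero, Finset.sum_const_zero, add_zero]
  refine hx.trans_eq (Finset.sum_congr rfl fun i _ => ?_)
  rw [Fin.sum_univ_castSucc]
  simp only [e1, mul_zero, add_zero]
  refine Finset.sum_congr rfl fun j _ => ?_
  simp [vecMulVec_apply]

theorem mon_of_pos {n : ℕ} (hn : 2 ≤ n) (h : PosProp n) : MonProp n := by
  intro b α hα A B hA hB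
  have hn' : (2:ℝ) ≤ n := by exact_mod_cast hn
  have h1 : 1 < α := by linarith
  have hsA := ((psd_iff_sum A).1 hA).1
  have hsB := ((psd_iff_sum B).1 hB).1
  have := family_psd (fun t => (A + t • B).map (FF b α))
    (fun t => α • (B ⊙ (A + t • B).map (FF (!b) (α - 1))))
    (fun t i j => by simp [hsA i j, hsB i j])
    (fun t i j => by
      have h1 := FF_deriv b h1 (A i j + t * B i j)
      have h2 : HasDerivAt (fun s : ℝ => A i j + s * B i j) (B i j) t := by
        simpa using ((hasDerivAt_id t).mul_const (B i j)).const_add (A i j)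
      have h3 := h1.comp t h2
      refine HasDerivAt.congr_deriv (f := fun s => FF b α (A i j + s * B i j)) h3 ?_
      simp [hadamard_apply]; ring)
    (fun t ht => by
      refine PosSemidef.smul ?_ (by linarith)
      refine hB.hadamard (h _ _ (by linarith) _ (hA.add (hB.smul ht))))
  simpa using this

theorem mon_all (n : ℕ) : MonProp n := by
  induction n with
  | zero => 
    intro b α hα A B hA hB
    rw [psd_iff_sum]
    exact ⟨fun i => i.elim0, fun x => by simp⟩
  | succ n ih =>
    rcases Nat.eq_zero_or_pos n with rfl | hn
    · intro b α hα A B hA hB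
      rw [psd_iff_sum]
      have hα' : 0 < α := by simpa using hα
      refine ⟨fun i j => by fin_cases i; fin_cases j; rfl, fun x => ?_⟩
      have := FF_mono b hα' (x := A 0 0) (y := A 0 0 + B 0 0) hA.diag_nonneg
        (by linarith [hB.diag_nonneg (i := 0)])
      simp
      have h2 : 0 ≤ x 0 * x 0 := mul_self_nonneg _
      nlinarith
    · exact mon_of_pos (by omega) (pos_of_mon ih)

theorem super_strict {n : ℕ} (hn : 2 ≤ n) (b : Bool) {α : ℝ} (hα : (n : ℝ) < α)
    {A B : Matrix (Fin n) (Fin n) ℝ} (hA : A.PosSemidef) (hB : B.PosSemidef) :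
    ((A + B).map (FF b α) - A.map (FF b α) - B.map (FF b α)).PosSemidef := by
  have hn' : (2:ℝ) ≤ n := by exact_mod_cast hn
  have h1 : 1 < α := by linarith
  have hsA := ((psd_iff_sum A).1 hA).1
  have hsB := ((psd_iff_sum B).1 hB).1
  have := family_psd (fun t => (t • B + A).map (FF b α) - (t • B).map (FF b α))
    (fun t => α • (B ⊙ ((t • B + A).map (FF (!b) (α - 1)) - (t • B).map (FF (!b) (α - 1)))))
    (fun t i j => by simp [hsA i j, hsB i j])
    (fun t i j => by
      have h3 := FF_deriv b h1 (t * B i j + A i j)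
      have h4 := FF_deriv b h1 (t * B i j)
      have h2' : HasDerivAt (fun s : ℝ => s * B i j) (B i j) t := by
        simpa using ((hasDerivAt_id t).mul_const (B i j))
      have h5 := (h3.comp t (h2'.add_const (A i j))).sub (h4.comp t h2')
      refine HasDerivAt.congr_deriv
        (f := fun s => FF b α (s * B i j + A i j) - FF b α (s * B i j)) h5 ?_
      simp [hadamard_apply]; ring)
    (fun t ht => by
      refine PosSemidef.smul ?_ (by linarith)
      refine hB.hadamard (mon_all n _ _ (by linarith) _ _ (hB.smul ht) hA))
  convert this using 1
  ext i j
  simp [FF_zero]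
  rw [add_comm (A i j)]
  ring

theorem super_all {n : ℕ} (hn : 2 ≤ n) (b : Bool) {α : ℝ} (hα : (n : ℝ) ≤ α)
    {A B : Matrix (Fin n) (Fin n) ℝ} (hA : A.PosSemidef) (hB : B.PosSemidef) :
    ((A + B).map (FF b α) - A.map (FF b α) - B.map (FF b α)).PosSemidef := by
  have hsA := ((psd_iff_sum A).1 hA).1
  have hsB := ((psd_iff_sum B).1 hB).1
  rw [psd_iff_sum]
  refine ⟨fun i j => by simp [hsA i j, hsB i j], fun x => ?_⟩
  have hn' : (2:ℝ) ≤ n := by exact_mod_cast hn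
  have hc : ∀ y : ℝ, ContinuousAt (fun a => FF b a y) α := by
    intro y
    by_cases hy : y = 0
    · simp only [hy, FF_zero]; exact continuousAt_const
    · have : Continuous fun a : ℝ => |y| ^ a :=
        Real.continuous_const_rpow (abs_pos.2 hy).ne'
      cases b
      · simpa [FF, phiF, hy] using this.continuousAt
      · simpa [FF, psiF, hy] using (this.continuousAt (x := α)).const_mul (Real.sign y)
  have hC : ContinuousAt (fun a => ∑ i, ∑ j, x i * x j *
      ((A + B).map (FF b a) - A.map (FF b a) - B.map (FF b a)) i j) α := by
    simp only [Matrix.sub_apply, map_apply]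
    refine tendsto_finsetSum _ fun i _ => tendsto_finsetSum _ fun j _ => ?_
    exact (((hc _).sub (hc _)).sub (hc _)).const_mul _
  refine ge_of_tendsto (hC.tendsto.mono_left (nhdsWithin_le_nhds (s := Set.Ioi α))) ?_
  filter_upwards [self_mem_nhdsWithin] with a ha
  exact ((psd_iff_sum _).1 (super_strict hn b (lt_of_le_of_lt hα ha) hA hB)).2 x

theorem had_psd {n : ℕ} {A B : Matrix (Fin n) (Fin n) ℝ} (hA : A.PosSemidef)
    (hB : B.PosSemidef) : (A ⊙ B).PosSemidef := hA.hadamard hB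

theorem super_nat {n : ℕ} {A B : Matrix (Fin n) (Fin n) ℝ} (hA : A.PosSemidef)
    (hB : B.PosSemidef) (k : ℕ) :
    ((A + B).map (· ^ (k + 1)) - A.map (· ^ (k + 1)) - B.map (· ^ (k + 1))).PosSemidef := by
  have hpow : ∀ {C : Matrix (Fin n) (Fin n) ℝ}, C.PosSemidef → ∀ k : ℕ,
      (C.map (· ^ (k + 1))).PosSemidef := by
    intro C hC k
    induction k with
    | zero => simpa using hC
    | succ k ih =>
      convert had_psd hC ih using 1
      ext i j; simp [hadamard_apply]; ring
  induction k with
  | zero =>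
    convert PosSemidef.zero using 1
    ext i j; simp
  | succ k ih =>
    convert (had_psd (hA.add hB) ih).add
      ((had_psd hA (hpow hB k)).add (had_psd hB (hpow hA k)))
      using 1
    ext i j; simp [hadamard_apply]; ring

/-- The polynomial vanishing at `c, c^2, …, c^m`. -/
noncomputable def nodePoly (c : ℝ) (m : ℕ) : Polynomial ℝ :=
  ∏ j ∈ Finset.range m, (Polynomial.X - Polynomial.C (c ^ (j + 1)))

theorem nodePoly_natDegree (c : ℝ) (m : ℕ) : (nodePoly c m).natDegree = m := by
  unfold nodePoly
  rw [Polynomial.natDegree_prod_of_monic _ _ (fun j _ => Polynomial.monic_X_sub_C _)]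
  simp only [Polynomial.natDegree_X_sub_C, Finset.sum_const, Finset.card_range, smul_eq_mul, mul_one]

theorem nodePoly_eval (c : ℝ) (m : ℕ) (y : ℝ) :
    (nodePoly c m).eval y = ∏ j ∈ Finset.range m, (y - c ^ (j + 1)) := by
  simp [nodePoly, Polynomial.eval_prod]

theorem sum2 {n : ℕ} {p : Polynomial ℝ} (hp : p.natDegree < n) (r : ℝ) :
    ∑ i : Fin n, ∑ j : Fin n, p.coeff i * p.coeff j * (r ^ (i : ℕ) * r ^ (j : ℕ))
      = (p.eval r) ^ 2 := by
  have h : p.eval r = ∑ i : Fin n, p.coeff i * r ^ (i : ℕ) := by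
    rw [Polynomial.eval_eq_sum_range' hp, Fin.sum_univ_eq_sum_range (fun i => p.coeff i * r ^ i)]
  rw [h, sq, Finset.sum_mul_sum]
  exact Finset.sum_congr rfl fun i _ => Finset.sum_congr rfl fun j _ => by ring

theorem nodePoly_eval_node (c : ℝ) {m l : ℕ} (h1 : 1 ≤ l) (h2 : l ≤ m) :
    (nodePoly c m).eval (c ^ l) = 0 := by
  rw [nodePoly_eval]
  refine Finset.prod_eq_zero (i := l - 1) (Finset.mem_range.2 (by omega)) ?_
  rw [Nat.sub_add_cancel h1, sub_self]

/-- A polynomial in `t v_i v_j` is killed except for its constant term. -/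
theorem sum_poly {n m : ℕ} (hm : m < n) (c t : ℝ) (C : ℕ → ℝ) :
    ∑ i : Fin n, ∑ j : Fin n, (nodePoly c m).coeff i * (nodePoly c m).coeff j *
      (∑ k ∈ Finset.range (m + 1), C k * (t * (c ^ (i : ℕ) * c ^ (j : ℕ))) ^ k)
      = C 0 * ((nodePoly c m).eval 1) ^ 2 := by
  have hd : (nodePoly c m).natDegree < n := by rw [nodePoly_natDegree]; exact hm
  have e : ∀ i j : Fin n, (nodePoly c m).coeff i * (nodePoly c m).coeff j *
      (∑ k ∈ Finset.range (m + 1), C k * (t * (c ^ (i : ℕ) * c ^ (j : ℕ))) ^ k)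
      = ∑ k ∈ Finset.range (m + 1), C k * t ^ k * ((nodePoly c m).coeff i *
        (nodePoly c m).coeff j * ((c ^ k) ^ (i : ℕ) * (c ^ k) ^ (j : ℕ))) := by
    intro i j
    rw [Finset.mul_sum]
    refine Finset.sum_congr rfl fun k _ => ?_
    rw [mul_pow, mul_pow, ← pow_mul, ← pow_mul, ← pow_mul, ← pow_mul, mul_comm (i : ℕ),
      mul_comm (j : ℕ)]
    ring
  simp only [e]
  have e2 : ∑ i : Fin n, ∑ j : Fin n, ∑ k ∈ Finset.range (m + 1), C k * t ^ k *
      ((nodePoly c m).coeff i * (nodePoly c m).coeff j *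
        ((c ^ k) ^ (i : ℕ) * (c ^ k) ^ (j : ℕ)))
      = ∑ k ∈ Finset.range (m + 1), C k * t ^ k * ((nodePoly c m).eval (c ^ k)) ^ 2 := by
    have : ∀ i : Fin n, ∑ j : Fin n, ∑ k ∈ Finset.range (m + 1), C k * t ^ k *
      ((nodePoly c m).coeff i * (nodePoly c m).coeff j *
        ((c ^ k) ^ (i : ℕ) * (c ^ k) ^ (j : ℕ))) = ∑ k ∈ Finset.range (m + 1), ∑ j : Fin n,
        C k * t ^ k * ((nodePoly c m).coeff i * (nodePoly c m).coeff j *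
        ((c ^ k) ^ (i : ℕ) * (c ^ k) ^ (j : ℕ))) := fun i => Finset.sum_comm
    simp only [this]
    rw [Finset.sum_comm]
    refine Finset.sum_congr rfl fun k _ => ?_
    rw [← sum2 hd]
    simp only [Finset.mul_sum]
  rw [e2, Finset.sum_eq_single 0]
  · simp
  · intro k hk hk0
    rw [nodePoly_eval_node c (Nat.one_le_iff_ne_zero.2 hk0)
      (Nat.lt_succ_iff.1 (Finset.mem_range.1 hk))]
    simp
  · simp

theorem taylor_rpow (α : ℝ) (m : ℕ) : ∃ C : ℕ → ℝ, C 0 = 1 ∧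
    (fun s : ℝ => (1 + s) ^ α - ∑ k ∈ Finset.range (m + 1), C k * s ^ k)
      =O[nhds 0] fun s => |s| ^ (m + 1) := by
  refine ⟨fun k => Ring.choose α k, by simp, ?_⟩
  have := (Real.one_add_rpow_hasFPowerSeriesAt_zero (a := α)).isBigO_sub_partialSum_pow (m + 1)
  refine this.congr (fun s => ?_) (fun s => by simp)
  simp only [FormalMultilinearSeries.partialSum, binomialSeries_apply, zero_add, smul_eq_mul,
    List.ofFn_const, List.prod_replicate]

/-- The rank one test matrices. -/
theorem test_matrices (n : ℕ) (c : ℝ) {t : ℝ} (ht : 0 ≤ t) :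
    ∃ A B : Matrix (Fin n) (Fin n) ℝ, A.PosSemidef ∧ B.PosSemidef ∧ A.rank ≤ 1 ∧ B.rank ≤ 1 ∧
      (∀ i j, A i j = 1) ∧ ∀ i j, B i j = t * (c ^ (i : ℕ) * c ^ (j : ℕ)) := by
  refine ⟨vecMulVec (fun _ => 1) (fun _ => 1),
    vecMulVec (fun i => √t * c ^ (i : ℕ)) (fun i => √t * c ^ (i : ℕ)), ?_, ?_,
    rank_vecMulVec_le _ _, rank_vecMulVec_le _ _, fun i j => by simp [vecMulVec_apply],
    fun i j => ?_⟩
  · simpa using posSemidef_vecMulVec_self_star (fun _ : Fin n => (1 : ℝ))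
  · simpa using posSemidef_vecMulVec_self_star (fun i : Fin n => √t * c ^ (i : ℕ))
  · rw [vecMulVec_apply]
    nth_rewrite 3 [← Real.mul_self_sqrt ht]
    ring

theorem nec_pow {n : ℕ} (hn : 2 ≤ n) {α : ℝ}
    (h : ∀ A B : Matrix (Fin n) (Fin n) ℝ, A.PosSemidef → B.PosSemidef →
        A.rank ≤ 1 → B.rank ≤ 1 → (∀ i j, 0 ≤ A i j) → (∀ i j, 0 ≤ B i j) →
        ((A + B).map (powF α) - A.map (powF α) - B.map (powF α)).PosSemidef) :
    (∃ k : ℕ, 0 < k ∧ α = k) ∨ (n : ℝ) ≤ α := by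
  by_contra hcon
  push Not at hcon
  obtain ⟨hk, hαn⟩ := hcon
  rcases le_or_gt α 0 with hα | hα
  · obtain ⟨A, B, hA, hB, hrA, hrB, eA, eB⟩ := test_matrices n 1 zero_le_one
    have := (h A B hA hB hrA hrB (by simp [eA]) (by simp [eB])).diag_nonneg
      (i := (⟨0, by omega⟩ : Fin n))
    simp [eA, eB, powF] at this
    norm_num at this
    have h2 : (2 : ℝ) ^ α ≤ 1 := Real.rpow_le_one_of_one_le_of_nonpos (by norm_num) hα
    linarith
  · set m := ⌊α⌋₊ with hm
    have hm1 : (m : ℝ) ≤ α := Nat.floor_le hα.le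
    have hm2 : α < m + 1 := Nat.lt_floor_add_one α
    have hmn : m < n := by exact_mod_cast hm1.trans_lt hαn
    obtain ⟨C, hC0, hC⟩ := taylor_rpow α m
    set x : Fin n → ℝ := fun i => (nodePoly 2 m).coeff i with hx
    set R : ℝ → ℝ := fun s : ℝ => (1 + s) ^ α - ∑ k ∈ Finset.range (m + 1), C k * s ^ k with hR
    set E : ℝ → ℝ := fun t => ∑ i : Fin n, ∑ j : Fin n,
      x i * x j * R (t * (2 ^ (i : ℕ) * 2 ^ (j : ℕ))) with hE
    set q := (nodePoly 2 m).eval ((2 : ℝ) ^ α) with hq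
    have hq0 : q ≠ 0 := by
      rw [hq, nodePoly_eval, Finset.prod_ne_zero_iff]
      intro j _ hj
      rw [sub_eq_zero, ← Real.rpow_natCast] at hj
      have hj' : α = ((j + 1 : ℕ) : ℝ) := by
        have := congrArg (Real.logb 2) hj
        rwa [Real.logb_rpow (by norm_num) (by norm_num),
          Real.logb_rpow (by norm_num) (by norm_num)] at this
      exact hk (j + 1) (Nat.succ_pos j) hj'
    have hEO : E =O[nhdsWithin 0 (Set.Ioi 0)] fun t => t ^ (m + 1) := by
      suffices hs : ∀ i j : Fin n, (fun t : ℝ => x i * x j * R (t * (2 ^ (i : ℕ) * 2 ^ (j : ℕ))))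
          =O[nhdsWithin 0 (Set.Ioi 0)] fun t => t ^ (m + 1) from
        Asymptotics.IsBigO.fun_sum fun i _ => Asymptotics.IsBigO.fun_sum fun j _ => hs i j
      intro i j
      refine Asymptotics.IsBigO.const_mul_left ?_ _
      have ht : Filter.Tendsto (fun t : ℝ => t * ((2:ℝ) ^ (i : ℕ) * 2 ^ (j : ℕ)))
          (nhdsWithin 0 (Set.Ioi 0)) (nhds 0) := by
        have : Continuous (fun t : ℝ => t * ((2:ℝ) ^ (i : ℕ) * 2 ^ (j : ℕ))) := by fun_prop
        have h0 := this.tendsto 0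
        rw [zero_mul] at h0
        exact h0.mono_left nhdsWithin_le_nhds
      refine (hC.comp_tendsto ht).trans ?_
      refine Asymptotics.IsBigO.of_bound (((2:ℝ) ^ (i : ℕ) * 2 ^ (j : ℕ)) ^ (m + 1)) ?_
      refine Filter.Eventually.of_forall fun t => ?_
      simp only [Function.comp, Real.norm_eq_abs, abs_pow, abs_abs, abs_mul, mul_pow]
      simp only [Nat.abs_ofNat]
      apply le_of_eq; ring
    have hlo : (fun t : ℝ => t ^ (m + 1)) =o[nhdsWithin 0 (Set.Ioi 0)] fun t => t ^ α := by
      rw [Asymptotics.isLittleO_iff_tendsto']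
      · have hd : 0 < (m : ℝ) + 1 - α := by linarith
        have h1 : Filter.Tendsto (fun t : ℝ => t ^ ((m : ℝ) + 1 - α))
            (nhdsWithin 0 (Set.Ioi 0)) (nhds 0) := by
          have h0 := (Real.continuous_rpow_const hd.le).tendsto (0 : ℝ)
          rw [Real.zero_rpow hd.ne'] at h0
          exact h0.mono_left nhdsWithin_le_nhds
        refine h1.congr' ?_
        filter_upwards [self_mem_nhdsWithin] with t ht
        have ht : 0 < t := ht
        rw [Real.rpow_sub ht]
        congr 1
        exact_mod_cast Real.rpow_natCast t (m + 1)
      · filter_upwards [self_mem_nhdsWithin] with t ht h0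
        exact absurd h0 (Real.rpow_pos_of_pos ht α).ne'
    have hb := (hEO.trans_isLittleO hlo).bound (c := q ^ 2 / 2) (by positivity)
    obtain ⟨t, htb, ht⟩ := (hb.and self_mem_nhdsWithin).exists
    have ht : 0 < t := ht
    obtain ⟨A, B, hA, hB, hrA, hrB, eA, eB⟩ := test_matrices n 2 ht.le
    have hpos := ((psd_iff_sum _).1 (h A B hA hB hrA hrB (by simp [eA])
      (fun i j => by rw [eB]; positivity))).2 x
    have hd : (nodePoly 2 m).natDegree < n := by rw [nodePoly_natDegree]; exact hmn
    have hsum : ∑ i, ∑ j, x i * x j *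
        ((A + B).map (powF α) - A.map (powF α) - B.map (powF α)) i j
        = E t + C 0 * ((nodePoly 2 m).eval 1) ^ 2 - ((nodePoly 2 m).eval 1) ^ 2
          - t ^ α * q ^ 2 := by
      rw [← sum_poly hmn 2 t C, hq, ← sum2 hd 1, ← sum2 hd ((2 : ℝ) ^ α), hE, Finset.mul_sum]
      simp only [← Finset.sum_add_distrib, ← Finset.sum_sub_distrib]
      refine Finset.sum_congr rfl fun i _ => ?_
      rw [Finset.mul_sum]
      simp only [← Finset.sum_add_distrib, ← Finset.sum_sub_distrib]
      refine Finset.sum_congr rfl fun j _ => ?_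
      simp only [Matrix.sub_apply, map_apply, Matrix.add_apply, eA, eB]
      have hw : (0:ℝ) < t * (2 ^ (i : ℕ) * 2 ^ (j : ℕ)) := by positivity
      have c2 : ∀ i : ℕ, ((2 : ℝ) ^ i) ^ α = (2 ^ α) ^ i := by
        intro i
        rw [← Real.rpow_natCast, ← Real.rpow_natCast, ← Real.rpow_mul (by norm_num),
          ← Real.rpow_mul (by norm_num), mul_comm]
      have e1 : powF α 1 = 1 := by simp [powF]
      have e2 : powF α (t * (2 ^ (i : ℕ) * 2 ^ (j : ℕ)))
          = t ^ α * ((2 ^ α) ^ (i : ℕ) * (2 ^ α) ^ (j : ℕ)) := by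
        rw [powF, if_neg hw.ne', Real.mul_rpow ht.le (by positivity),
          Real.mul_rpow (by positivity) (by positivity), c2, c2]
      have e3 : powF α (1 + t * (2 ^ (i : ℕ) * 2 ^ (j : ℕ)))
          = (1 + t * (2 ^ (i : ℕ) * 2 ^ (j : ℕ))) ^ α := by
        rw [powF, if_neg (by linarith)]
      rw [e1, e2, e3, hR]
      simp only [one_pow, hx]
      ring
    rw [hsum, hC0] at hpos
    have hta : 0 < t ^ α := Real.rpow_pos_of_pos ht α
    rw [Real.norm_eq_abs, Real.norm_eq_abs, abs_of_pos hta] at htb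
    have h1 := (le_abs_self _).trans htb
    have h2 : 0 < q ^ 2 * t ^ α := by positivity
    nlinarith

theorem FF_one (b : Bool) (α : ℝ) : FF b α 1 = 1 := by
  rw [FF_of_pos b α one_pos, Real.one_rpow]

theorem FF_pow (b : Bool) (α y : ℝ) (i : ℕ) : FF b α (y ^ i) = (FF b α y) ^ i := by
  induction i with
  | zero => simp [FF_one]
  | succ i ih => rw [pow_succ, FF_mul, ih, pow_succ]

theorem nec_par {n : ℕ} (b : Bool) {k : ℕ} (hk : k < n)
    (hb : if b then Even k else Odd k)
    (h : ∀ A B : Matrix (Fin n) (Fin n) ℝ, A.PosSemidef → B.PosSemidef →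
        A.rank ≤ 1 → B.rank ≤ 1 →
        ((A + B).map (FF b k) - A.map (FF b k) - B.map (FF b k)).PosSemidef) : False := by
  set t : ℝ := 1 / (2 * 4 ^ n) with ht_def
  have ht : 0 < t := by positivity
  obtain ⟨A, B, hA, hB, hrA, hrB, eA, eB⟩ := test_matrices n (-2) ht.le
  set x : Fin n → ℝ := fun i => (nodePoly (-2) k).coeff i with hx
  have hpos := ((psd_iff_sum _).1 (h A B hA hB hrA hrB)).2 x
  have hd : (nodePoly (-2) k).natDegree < n := by rw [nodePoly_natDegree]; exact hk
  set q := (nodePoly (-2) k).eval (FF b k (-2)) with hq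
  have hq0 : q ≠ 0 := by
    rw [hq, nodePoly_eval, Finset.prod_ne_zero_iff]
    intro j _ hj
    rw [sub_eq_zero] at hj
    have hv : FF b k (-2) = if b then -2 ^ k else 2 ^ k := by
      cases b
      · simp [FF, phiF]
      · simp [FF, psiF, Real.sign_of_neg]
    have habs : (2:ℝ) ^ k = 2 ^ (j + 1) := by
      have := congrArg abs hj
      rw [hv, abs_pow] at this
      cases b <;> simpa using this
    have hkj : k = j + 1 := Nat.pow_right_injective (le_refl 2) (by exact_mod_cast habs)
    rw [← hkj, hv] at hj
    have h2 : (0:ℝ) < 2 ^ k := by positivity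
    cases b
    · have hb : Odd k := by simpa using hb
      rw [hb.neg_pow] at hj
      simp at hj
      linarith
    · have hb : Even k := by simpa using hb
      rw [hb.neg_pow] at hj
      simp at hj
      linarith
  have hsum : ∑ i, ∑ j, x i * x j *
      ((A + B).map (FF b k) - A.map (FF b k) - B.map (FF b k)) i j
      = (fun l => (k.choose l : ℝ)) 0 * ((nodePoly (-2) k).eval 1) ^ 2
        - ((nodePoly (-2) k).eval 1) ^ 2 - t ^ k * q ^ 2 := by
    rw [← sum_poly hk (-2) t (fun l => (k.choose l : ℝ)), hq, ← sum2 hd 1,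
      ← sum2 hd (FF b k (-2)), Finset.mul_sum]
    simp only [← Finset.sum_sub_distrib]
    refine Finset.sum_congr rfl fun i _ => ?_
    rw [Finset.mul_sum]
    simp only [← Finset.sum_sub_distrib]
    refine Finset.sum_congr rfl fun j _ => ?_
    simp only [Matrix.sub_apply, map_apply, Matrix.add_apply, eA, eB]
    set w : ℝ := (-2) ^ (i : ℕ) * (-2) ^ (j : ℕ) with hw
    have hwb : |w| ≤ 4 ^ n := by
      rw [hw, abs_mul, abs_pow, abs_pow, abs_neg, Nat.abs_ofNat,
        show (4:ℝ) = 2 * 2 by norm_num, mul_pow]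
      have h1 : (2:ℝ) ^ (i : ℕ) ≤ 2 ^ n := pow_le_pow_right₀ (by norm_num) i.2.le
      have h2 : (2:ℝ) ^ (j : ℕ) ≤ 2 ^ n := pow_le_pow_right₀ (by norm_num) j.2.le
      gcongr
    have htw : 0 < 1 + t * w := by
      have h1 : |t * w| ≤ 1 / 2 := by
        rw [abs_mul, abs_of_pos ht]
        calc t * |w| ≤ t * 4 ^ n := by gcongr
          _ = 1 / 2 := by rw [ht_def]; field_simp
      have := (abs_le.1 h1).1
      linarith
    have e1 : FF b k (1 + t * w)
        = ∑ l ∈ Finset.range (k + 1), (k.choose l : ℝ) * (t * w) ^ l := by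
      rw [FF_of_pos b _ htw, Real.rpow_natCast, add_comm, add_pow]
      refine Finset.sum_congr rfl fun l _ => by rw [one_pow]; ring
    have e2 : FF b k (t * w) = t ^ k * (FF b k (-2) ^ (i : ℕ) * FF b k (-2) ^ (j : ℕ)) := by
      rw [FF_mul, hw, FF_mul, FF_pow, FF_pow, FF_of_pos b _ ht, Real.rpow_natCast]
    rw [e1, e2, FF_one]
    simp only [one_pow, hx]
    ring
  rw [hsum] at hpos
  have : 0 < t ^ k * q ^ 2 := by positivity
  simp at hpos
  linarith

theorem FF_eq_powF (b : Bool) (α : ℝ) {y : ℝ} (hy : 0 ≤ y) : FF b α y = powF α y := by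
  rcases hy.eq_or_lt with rfl | hy
  · simp [FF_zero, powF]
  · rw [FF_of_pos b α hy, powF, if_neg hy.ne']

theorem psd_powF_iff (b : Bool) (α : ℝ) {n : ℕ} {A B : Matrix (Fin n) (Fin n) ℝ}
    (hA : ∀ i j, 0 ≤ A i j) (hB : ∀ i j, 0 ≤ B i j) :
    (A + B).map (powF α) - A.map (powF α) - B.map (powF α)
      = (A + B).map (FF b α) - A.map (FF b α) - B.map (FF b α) := by
  ext i j
  simp only [Matrix.sub_apply, map_apply, Matrix.add_apply]
  rw [FF_eq_powF b α (hA i j), FF_eq_powF b α (hB i j),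
    FF_eq_powF b α (add_nonneg (hA i j) (hB i j))]

theorem FF_nat (b : Bool) {k : ℕ} (hk0 : 0 < k) (hb : if b then Odd k else Even k) (y : ℝ) :
    FF b k y = y ^ k := by
  by_cases hy : y = 0
  · rw [hy, FF_zero, zero_pow hk0.ne']
  cases b
  · have hb : Even k := by simpa using hb
    simp [FF, phiF, hy, hb.pow_abs]
  · have hb : Odd k := by simpa using hb
    simp only [FF, psiF, hy, if_true, if_false, Real.rpow_natCast]
    rcases lt_or_gt_of_ne hy with h | h
    · rw [Real.sign_of_neg h, abs_of_neg h, hb.neg_pow]; ring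
    · rw [Real.sign_of_pos h, abs_of_pos h, one_mul]

theorem main_FF {n : ℕ} (hn : 2 ≤ n) (b : Bool) (α : ℝ) :
    (∀ A B : Matrix (Fin n) (Fin n) ℝ, A.PosSemidef → B.PosSemidef →
        A.rank ≤ 1 → B.rank ≤ 1 →
        ((A + B).map (FF b α) - A.map (FF b α) - B.map (FF b α)).PosSemidef) ↔
      ((∃ k : ℕ, 0 < k ∧ (if b then Odd k else Even k) ∧ α = k) ∨ (n : ℝ) ≤ α) := by
  constructor
  · intro h
    rcases nec_pow hn (α := α) (fun A B hA hB hrA hrB hA0 hB0 => by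
      rw [psd_powF_iff b α hA0 hB0]; exact h A B hA hB hrA hrB) with ⟨k, hk, rfl⟩ | h1
    · by_cases hkn : n ≤ k
      · exact Or.inr (by exact_mod_cast hkn)
      · left
        refine ⟨k, hk, ?_, rfl⟩
        by_contra hc
        refine nec_par b (not_le.1 hkn) ?_ h
        cases b
        · simpa using hc
        · simpa using hc
    · exact Or.inr h1
  · rintro (⟨k, hk, hb, rfl⟩ | h) A B hA hB - -
    · have := super_nat hA hB (k - 1)
      rw [Nat.sub_add_cancel hk] at this
      have e : FF b (k : ℝ) = (· ^ k) := funext (FF_nat b hk hb)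
      rw [e]
      exact this
    · exact super_all hn b h hA hB

/-- Loewner super-additivity of `ψ_α[-]`, `φ_α[-]` and the entrywise power on rank-one
positive semidefinite matrices is characterized by the same sets of powers as in the
general case. -/
theorem stmt13 (n : ℕ) (hn : 2 ≤ n) (α : ℝ) :
    ((∀ A B : Matrix (Fin n) (Fin n) ℝ, A.PosSemidef → B.PosSemidef →
        A.rank ≤ 1 → B.rank ≤ 1 →
        ((A + B).map (psiF α) - A.map (psiF α) - B.map (psiF α)).PosSemidef) ↔
      ((∃ k : ℕ, Odd k ∧ α = k) ∨ (n : ℝ) ≤ α)) ∧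
    ((∀ A B : Matrix (Fin n) (Fin n) ℝ, A.PosSemidef → B.PosSemidef →
        A.rank ≤ 1 → B.rank ≤ 1 →
        ((A + B).map (phiF α) - A.map (phiF α) - B.map (phiF α)).PosSemidef) ↔
      ((∃ k : ℕ, Even k ∧ 0 < k ∧ α = k) ∨ (n : ℝ) ≤ α)) ∧
    ((∀ A B : Matrix (Fin n) (Fin n) ℝ, A.PosSemidef → B.PosSemidef →
        A.rank ≤ 1 → B.rank ≤ 1 → (∀ i j, 0 ≤ A i j) → (∀ i j, 0 ≤ B i j) →
        ((A + B).map (powF α) - A.map (powF α) - B.map (powF α)).PosSemidef) ↔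
      ((∃ k : ℕ, 0 < k ∧ α = k) ∨ (n : ℝ) ≤ α)) := by
  have ht : FF true α = psiF α := by funext y; simp [FF]
  have hf : FF false α = phiF α := by funext y; simp [FF]
  refine ⟨?_, ?_, nec_pow hn, ?_⟩
  · have := main_FF hn true α
    rw [ht] at this
    rw [this]
    refine or_congr_left (exists_congr fun k => ?_)
    simp only [if_true]
    exact ⟨fun h => h.2, fun h => ⟨h.1.pos, h⟩⟩
  · have := main_FF hn false α
    rw [hf] at this
    rw [this]
    refine or_congr_left (exists_congr fun k => ?_)
    simp only [Bool.false_eq_true, if_false]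
    tauto
  · rintro h A B hA hB hrA hrB hA0 hB0
    rcases h with ⟨k, hk, e⟩ | h
    · rcases Nat.even_or_odd k with hp | hp
      · rw [psd_powF_iff false α hA0 hB0]
        exact (main_FF hn false α).2 (Or.inl ⟨k, hk, by simpa using hp, e⟩) A B hA hB hrA hrB
      · rw [psd_powF_iff true α hA0 hB0]
        exact (main_FF hn true α).2 (Or.inl ⟨k, hk, by simpa using hp, e⟩) A B hA hB hrA hrB
    · rw [psd_powF_iff true α hA0 hB0]
      exact super_all hn true h hA hB
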